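/- For all integers m,t ≥ 1 there is an integer u ≥ 1 such that the glue string S_t^(m) equals either P_u^(m+1) or P_u^(m+1)·(m+1), and in the latter case u ≥ 2. More precisely, one has ι_m(t+1) − ι_m(t) ∈ {1,2}, and with u := ord_{m+1}(ι_m(t)+1) + 1: if ι_m(t+1) = ι_m(t)+1 then S_t^(m) = P_u^(m+1), while if ι_m(t+1) = ι_m(t)+2 then S_t^(m) = P_u^(m+1)·(m+1) and u ≥ 2. -/

import Mathlib

open List Filter

open scoped Classical

noncomputable section

/-- The curling number of a finite string: the largest `k` such that
`S = X ++ Y^k` with `Y` nonempty; by convention `curl [] = 1`. -/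
def curl (S : List ℕ) : ℕ :=
  max 1 (sSup {k | ∃ X Y : List ℕ, Y ≠ [] ∧ S = X ++ (List.replicate k Y).flatten})

/-- The prefix of length `n` of the level-`m` Gijswijt sequence `A^(m)`. -/
def gPrefix (m : ℕ) : ℕ → List ℕ
  | 0 => []
  | n + 1 => gPrefix m n ++ [max m (curl (gPrefix m n))]

/-- `gij m p` is the `p`-th term (1-indexed) of the level-`m` Gijswijt sequence `A^(m)`. -/
def gij (m p : ℕ) : ℕ := max m (curl (gPrefix m (p - 1)))

/-- Standing hypothesis: for every `m ≥ 1`, the sets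
`{k ≥ 0 : C(A^(m)[1,k]) ≤ m}` and `{k ≥ 0 : C(A^(m+1)[1,k]) ≤ m}` are infinite. -/
def StandingHyp : Prop :=
  ∀ m : ℕ, 1 ≤ m →
    {k : ℕ | curl (gPrefix m k) ≤ m}.Infinite ∧
    {k : ℕ | curl (gPrefix (m + 1) k) ≤ m}.Infinite

/-- Length of `π^(m)(1,x)`: the `x`-th smallest (0-indexed) element of
`{k : C(A^(m)[1,k]) ≤ m}`. -/
def piLen (m x : ℕ) : ℕ := Nat.nth (fun k => curl (gPrefix m k) ≤ m) x

/-- `π^(m)(1,x)`: the prefix of `A^(m)` with exactly `x` occurrences of `m`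
and curling number at most `m`. -/
def piStr (m x : ℕ) : List ℕ := gPrefix m (piLen m x)

/-- `β^(m)(t)`, the length of `B_t^(m)`. -/
def beta (m t : ℕ) : ℕ := piLen m ((m + 1) ^ (t - 1))

/-- `B_t^(m) := π^(m)(1,(m+1)^(t-1))`. -/
def Bstr (m t : ℕ) : List ℕ := piStr m ((m + 1) ^ (t - 1))

/-- `τ^(m)(t)`, the length of `T_t^(m)`. -/
def tau (m t : ℕ) : ℕ := Nat.nth (fun k => curl (gPrefix (m + 1) k) ≤ m) (t - 1)

/-- `T_t^(m)`: the `t`-th shortest prefix of `A^(m+1)` with curling number at most `m`. -/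
def Tstr (m t : ℕ) : List ℕ := gPrefix (m + 1) (tau m t)

/-- `φ^(m)(n)`: the least `p ≥ 1` with `A^(m)(p) = n`. -/
def phi (m n : ℕ) : ℕ := sInf {p : ℕ | 1 ≤ p ∧ gij m p = n}

/-- `t^(m)(n) = 1 + log_{m+1} #\{i ≤ φ^(m)(n) : A^(m)(i) = m\}`. -/
def tfun (m n : ℕ) : ℕ := 1 + Nat.log (m + 1) ((gPrefix m (phi m n)).count m)

/-- `χ^(b)(a)`: read the base-`b` digits of `a` as base-`(b+1)` digits. -/
def chi (b a : ℕ) : ℕ := Nat.ofDigits (b + 1) (Nat.digits b a)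

/-- `ι_m(t)`: read the base-`(m+2)` digits of the number of occurrences of `m+1`
in `T_t^(m)` as base-`(m+1)` digits. -/
def iota (m t : ℕ) : ℕ :=
  Nat.ofDigits (m + 1) (Nat.digits (m + 2) ((Tstr m t).count (m + 1)))

/-- `ι_m⁻¹(p)`: the largest `x ≥ 1` with `ι_m(x) ≤ p`. -/
def iotaInv (m p : ℕ) : ℕ := sSup {x : ℕ | 1 ≤ x ∧ iota m x ≤ p}

/-- `ord_b(n)`: the `b`-adic valuation of `n`. -/
def ordb (b n : ℕ) : ℕ := sSup {z : ℕ | b ^ z ∣ n}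

/-- The largest base-`b` digit of `n`. -/
def maxdigit (b n : ℕ) : ℕ := (Nat.digits b n).foldr max 0

/-- Auxiliary function for the level-`m` expansion: `lexpAux m a k = a_{m+1+k}`. -/
def lexpAux (m a : ℕ) : ℕ → ℕ
  | 0 => a
  | k + 1 => iota (m + 1 + k) (ordb (m + 1 + k) (lexpAux m a k) + 1)

/-- `lexp m a l = a_l`, the `l`-th term of the level-`m` expansion of `a`. -/
def lexp (m a l : ℕ) : ℕ := lexpAux m a (l - (m + 1))

/-- The last element `n` of `π^(m+1)(1, χ^(m+1)(a))`; the level-`m` expansion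
of `a` is `a_{m+1}, …, a_n`. -/
def levelEnd (m a : ℕ) : ℕ := (piStr (m + 1) (chi (m + 1) a)).getLastD 0

/-- `V_m := {v ≥ 0 : C(T_{v+1}^(m+1)) ≤ m}`. -/
def Vset (m : ℕ) : Set ℕ := {v | curl (Tstr (m + 1) (v + 1)) ≤ m}

/-- `Q := {α ≥ 0 : C(T_{α+1}^(2)) = 1}`. -/
def Qset : Set ℕ := {a | curl (Tstr 2 (a + 1)) = 1}

/-- `R := {(a,b) : a ∈ Q, a < b, no suffix S of T_{a+1}^(2) with T_{a+1}^(2)·S = T_{b+1}^(2)}`. -/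
def Rset : Set (ℕ × ℕ) :=
  {p | p.1 ∈ Qset ∧ p.1 < p.2 ∧
    ¬∃ S : List ℕ, S <:+ Tstr 2 (p.1 + 1) ∧ Tstr 2 (p.1 + 1) ++ S = Tstr 2 (p.2 + 1)}

/-- The digit of `x` in base `b` at (1-indexed) position `i`, i.e. the coefficient
of `b^(i-1)`. -/
def digitAt (b x i : ℕ) : ℕ := (Nat.digits b x).getD (i - 1) 0

/-- `u` is the (1-indexed) position of the second nonzero base-`b` digit of `x`
(the first nonzero digit being at position `ord_b(x)+1`). -/
def IsSecondNonzero (b x u : ℕ) : Prop :=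
  ordb b x + 1 < u ∧ digitAt b x u ≠ 0 ∧
    ∀ i, ordb b x + 1 < i → i < u → digitAt b x i = 0

/-- `𝒮_b`: pairs `(a,a')` with `1 ≤ a < a'` such that for some position `y` the
base-`b` digits of `a` and `a'` agree away from `y` and twice the `y`-th digit of `a`
is at least the `y`-th digit of `a'`. -/
def Sset (b : ℕ) : Set (ℕ × ℕ) :=
  {p | 1 ≤ p.1 ∧ p.1 < p.2 ∧
    ∃ y : ℕ, (∀ i, i ≠ y → (Nat.digits b p.1).getD i 0 = (Nat.digits b p.2).getD i 0) ∧
      (Nat.digits b p.2).getD y 0 ≤ 2 * (Nat.digits b p.1).getD y 0}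

/-- The glue string `S_t^(m)`, so that `T_{t+1}^(m) = T_t^(m) ++ glue m t`. -/
def glue (m t : ℕ) : List ℕ := (gPrefix (m + 1) (tau m (t + 1))).drop (tau m t)

/-- The strings `P_t^(m)`: `P_1^(m) = (m)` and `P_{t+1}^(m) = P_t^(m)·B_t^(m)·S_t^(m)`. -/
def Pstr (m : ℕ) : ℕ → List ℕ
  | 0 => []
  | 1 => [m]
  | t + 2 => Pstr m (t + 1) ++ Bstr m (t + 1) ++ glue m (t + 1)

end

/-! ### Curling numbers -/

theorem bddAbove_curl_set (S : List ℕ) :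
    BddAbove {k | ∃ X Y : List ℕ, Y ≠ [] ∧ S = X ++ (List.replicate k Y).flatten} := by
  refine ⟨S.length, ?_⟩
  rintro k ⟨X, Y, hY, rfl⟩
  have : 0 < Y.length := List.length_pos_iff.2 hY
  simp only [List.length_append, List.length_flatten, List.map_replicate, List.sum_replicate,
    smul_eq_mul]
  nlinarith

theorem le_curl {S X Y : List ℕ} {k : ℕ} (hY : Y ≠ [])
    (h : S = X ++ (List.replicate k Y).flatten) : k ≤ curl S :=
  le_max_of_le_right (le_csSup (bddAbove_curl_set S) ⟨X, Y, hY, h⟩)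

theorem curl_le {S : List ℕ} {n : ℕ} (hn : 1 ≤ n)
    (h : ∀ k X Y, Y ≠ [] → S = X ++ (List.replicate k Y).flatten → k ≤ n) : curl S ≤ n := by
  refine max_le hn (csSup_le' ?_)
  rintro k ⟨X, Y, hY, hS⟩
  exact h k X Y hY hS

theorem curl_nil : curl [] = 1 := by
  refine le_antisymm (curl_le le_rfl ?_) (le_max_left _ _)
  intro k X Y hY h
  have h1 := congrArg List.length h
  have : 0 < Y.length := List.length_pos_iff.2 hY
  simp only [List.length_append, List.length_flatten, List.map_replicate, List.sum_replicate,
    smul_eq_mul, List.length_nil] at h1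
  nlinarith

theorem curl_le_curl_append (A S : List ℕ) : curl S ≤ curl (A ++ S) := by
  refine curl_le (le_max_left _ _) ?_
  rintro k X Y hY rfl
  exact le_curl (X := A ++ X) hY (by simp)

theorem two_le_curl {U h : List ℕ} (hh : h ≠ []) (hU : h <:+ U) : 2 ≤ curl (U ++ h) := by
  obtain ⟨V, rfl⟩ := hU
  exact le_curl (X := V) hh (by simp [List.replicate_succ])

/-! ### Words written as sequences of gaps between occurrences of a letter -/

/-- The word `b f(1) b f(2) ⋯ b f(n)`. -/
def gapWord (b : ℕ) (f : ℕ → List ℕ) : ℕ → List ℕ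
  | 0 => []
  | n + 1 => gapWord b f n ++ b :: f (n + 1)

theorem gapWord_add (b : ℕ) (f : ℕ → List ℕ) (n k : ℕ) :
    gapWord b f (n + k) = gapWord b f n ++ gapWord b (fun i => f (n + i)) k := by
  induction k with
  | zero => simp [gapWord]
  | succ k ih => rw [← add_assoc, gapWord, ih, gapWord, List.append_assoc]; rfl

theorem gapWord_congr {b : ℕ} {f g : ℕ → List ℕ} {n : ℕ}
    (h : ∀ i, 1 ≤ i → i ≤ n → f i = g i) : gapWord b f n = gapWord b g n := by
  induction n with
  | zero => rfl
  | succ n ih =>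
    rw [gapWord, gapWord, ih fun i h1 h2 => h i h1 (by omega), h (n + 1) (by omega) le_rfl]

theorem count_gapWord {b : ℕ} {f : ℕ → List ℕ} (hf : ∀ i, b ∉ f i) (n : ℕ) :
    (gapWord b f n).count b = n := by
  induction n with
  | zero => rfl
  | succ n ih => simp [gapWord, ih, List.count_eq_zero_of_not_mem (hf (n + 1))]

theorem gapWord_split {b : ℕ} {f : ℕ → List ℕ} (hf : ∀ i, b ∉ f i) {n : ℕ} {A B : List ℕ}
    (h : gapWord b f n = A ++ b :: B) : ∃ k l, n = k + l ∧ A = gapWord b f k := by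
  induction n generalizing B with
  | zero => simp [gapWord] at h
  | succ n ih =>
    rw [gapWord, List.append_eq_append_iff] at h
    rcases h with ⟨a, rfl, ha⟩ | ⟨a, ha, ha'⟩
    · cases a with
      | nil => exact ⟨n, 1, rfl, by simp⟩
      | cons d a =>
        simp only [List.cons_append, List.cons.injEq] at ha
        exact absurd (by rw [ha.2]; simp) (hf (n + 1))
    · cases a with
      | nil => exact ⟨n, 1, rfl, by simpa using ha.symm⟩
      | cons d a =>
        simp only [List.cons_append, List.cons.injEq] at ha'
        obtain ⟨k, l, hkl, hA⟩ := ih (ha.trans (by rw [ha'.1]))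
        exact ⟨k, l + 1, by omega, hA⟩

theorem gapWord_injOn {b : ℕ} {f g : ℕ → List ℕ} (hf : ∀ i, b ∉ f i) (hg : ∀ i, b ∉ g i) {n : ℕ}
    (h : gapWord b f n = gapWord b g n) : ∀ i, 1 ≤ i → i ≤ n → f i = g i := by
  induction n with
  | zero => intro i h1 h2; omega
  | succ n ih =>
    obtain ⟨k, l, -, hk⟩ := gapWord_split hf (A := gapWord b g n) (B := g (n + 1)) h
    have hc := congrArg (List.count b) hk
    rw [count_gapWord hf, count_gapWord hg] at hc
    subst hc
    rw [gapWord, gapWord, hk] at h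
    have h' := List.append_cancel_left h
    simp only [List.cons.injEq, true_and] at h'
    intro i h1 h2
    rcases Nat.lt_or_ge n i with h3 | h3
    · obtain rfl : i = n + 1 := by omega
      exact h'
    · exact ih hk.symm i h1 h3

theorem gapWord_power {b : ℕ} {f : ℕ → List ℕ} (hf : ∀ i, b ∉ f i) {k n : ℕ} {X Z : List ℕ}
    (h : gapWord b f n = X ++ (List.replicate k (b :: Z)).flatten) :
    n = X.count b + k * (b :: Z).count b ∧ X = gapWord b f (X.count b) ∧
      ∀ j < k, b :: Z =
        gapWord b (fun i => f (X.count b + j * (b :: Z).count b + i)) ((b :: Z).count b) := by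
  induction k generalizing n with
  | zero =>
    simp only [List.replicate_zero, List.flatten_nil, List.append_nil] at h
    subst h
    simp [count_gapWord hf]
  | succ k ih =>
    rw [List.replicate_succ', List.flatten_append, ← List.append_assoc] at h
    simp only [List.flatten_cons, List.flatten_nil, List.append_nil] at h
    obtain ⟨r, l, rfl, hr⟩ := gapWord_split hf h
    obtain ⟨h1, h2, h3⟩ := ih hr.symm
    rw [gapWord_add, ← hr] at h
    have h' := List.append_cancel_left h
    have hl := congrArg (List.count b) h'
    rw [count_gapWord fun i => hf _] at hl
    refine ⟨by rw [h1, hl]; ring, h2, fun j hj => ?_⟩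
    rcases Nat.lt_succ_iff_lt_or_eq.1 hj with hj | rfl
    · exact h3 j hj
    · rw [← h1, ← hl, h']

theorem flatten_replicate_conj (h Z : List ℕ) (k : ℕ) :
    (List.replicate k (h ++ Z)).flatten ++ h = h ++ (List.replicate k (Z ++ h)).flatten := by
  induction k with
  | zero => simp
  | succ k ih => simp [List.replicate_succ, ih]

theorem suffix_of_append_eq {b : ℕ} {X h A V : List ℕ} (hb : b ∉ h)
    (e : X ++ h = A ++ b :: V) : h <:+ V := by
  rcases List.append_eq_append_iff.1 e with ⟨a, -, rfl⟩ | ⟨a, -, ha⟩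
  · simp at hb
  · cases a with
    | nil => simp only [List.nil_append] at ha; simp [← ha] at hb
    | cons d a =>
      simp only [List.cons_append, List.cons.injEq] at ha
      exact ⟨a, ha.2.symm⟩

/-- A power of a word containing `b` at the end of a gap word forces the gaps to be periodic. -/
theorem gapWord_periodic {b : ℕ} {f : ℕ → List ℕ} (hf : ∀ i, b ∉ f i) {k n : ℕ} {X Y : List ℕ}
    (hn : 1 ≤ n) (hk : 1 ≤ k) (hY : b ∈ Y)
    (e : gapWord b f n = X ++ (List.replicate k Y).flatten) :
    ∃ h N n₀, b ∉ h ∧ 1 ≤ N ∧ n = n₀ + k * N ∧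
      (∀ i, n₀ < i → i + N < n → f i = f (i + N)) ∧
      (∀ j, 1 ≤ j → j < k → f (n₀ + j * N) = f n ++ h) ∧
      (h = [] ∨ 1 ≤ n₀ ∧ h <:+ f n₀) := by
  obtain ⟨h, R, rfl, hb⟩ := List.eq_append_cons_of_mem hY
  obtain ⟨n, rfl⟩ : ∃ l, n = l + 1 := ⟨n - 1, by omega⟩
  set g : ℕ → List ℕ := Function.update f (n + 1) (f (n + 1) ++ h) with hg
  have hgn : g (n + 1) = f (n + 1) ++ h := by simp [hg]
  have hgf : ∀ i, i ≠ n + 1 → g i = f i := fun i hi => by simp [hg, hi]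
  have hgb : ∀ i, b ∉ g i := by
    intro i
    rcases eq_or_ne i (n + 1) with rfl | hi
    · rw [hgn]; simp [hf, hb]
    · rw [hgf i hi]; exact hf i
  have e' : gapWord b g (n + 1) = (X ++ h) ++ (List.replicate k (b :: (R ++ h))).flatten := by
    rw [gapWord, gapWord_congr (g := f) fun i _ hi => hgf i (by omega), hgn]
    have := congrArg (· ++ h) e
    simp only [gapWord, List.append_assoc, flatten_replicate_conj] at this
    simpa using this
  obtain ⟨h1, h2, h3⟩ := gapWord_power hgb e'
  set n₀ := (X ++ h).count b
  set N := (b :: (R ++ h)).count b with hN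
  have hN1 : 1 ≤ N := by simp [hN]
  have key : ∀ i j, j < k → 1 ≤ i → i ≤ N → g (n₀ + j * N + i) = g (n₀ + (k - 1) * N + i) :=
    fun i j hj hi1 hi2 => gapWord_injOn (f := fun i => g (n₀ + j * N + i))
      (g := fun i => g (n₀ + (k - 1) * N + i)) (fun _ => hgb _) (fun _ => hgb _)
      ((h3 j hj).symm.trans (h3 (k - 1) (by omega))) i hi1 hi2
  obtain ⟨k, rfl⟩ : ∃ l, k = l + 1 := ⟨k - 1, by omega⟩
  refine ⟨h, N, n₀, hb, hN1, h1, fun i hi1 hi2 => ?_, fun j hj1 hj2 => ?_, ?_⟩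
  · rw [← hgf i (by omega), ← hgf (i + N) (by omega)]
    have hd := Nat.div_add_mod (i - n₀ - 1) N
    have hm := Nat.mod_lt (i - n₀ - 1) hN1
    set j := (i - n₀ - 1) / N
    set r := (i - n₀ - 1) % N
    have hi : i = n₀ + j * N + (r + 1) := by rw [mul_comm]; omega
    have hj : j + 1 < k + 1 := by
      by_contra hcon
      have : k * N ≤ j * N := Nat.mul_le_mul_right _ (by omega)
      have h4 : (k + 1) * N = k * N + N := by ring
      omega
    have hi' : i + N = n₀ + (j + 1) * N + (r + 1) := by rw [hi]; ring
    rw [hi', hi, key _ _ (by omega) (by omega) (by omega), key _ _ hj (by omega) (by omega)]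
  · obtain ⟨j, rfl⟩ : ∃ l, j = l + 1 := ⟨j - 1, by omega⟩
    have hlt : (j + 1) * N < (k + 1) * N := Nat.mul_lt_mul_of_pos_right hj2 hN1
    rw [← hgf _ (by omega), ← hgn, h1]
    have := key N j (by omega) hN1 le_rfl
    convert this using 2
    · ring
    · simp only [Nat.add_sub_cancel]; ring
  · rcases Nat.eq_zero_or_pos n₀ with h0 | h0
    · rw [h0, gapWord, List.append_eq_nil_iff] at h2
      exact Or.inl h2.2
    · obtain ⟨l, hl⟩ : ∃ l, n₀ = l + 1 := ⟨n₀ - 1, by omega⟩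
      refine Or.inr ⟨h0, ?_⟩
      have : 1 * N ≤ (k + 1) * N := Nat.mul_le_mul_right _ (by omega)
      rw [← hgf n₀ (by omega), hl]
      rw [hl, gapWord] at h2
      exact suffix_of_append_eq hb h2

/-- Periodic gaps produce powers. -/
theorem gapWord_eq_power {b : ℕ} {f : ℕ → List ℕ} {n₀ N k : ℕ}
    (h : ∀ i, n₀ < i → i + N ≤ n₀ + k * N → f i = f (i + N)) :
    gapWord b f (n₀ + k * N) = gapWord b f n₀ ++
      (List.replicate k (gapWord b (fun i => f (n₀ + i)) N)).flatten := by
  induction k generalizing n₀ with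
  | zero => simp
  | succ k ih =>
    have e : n₀ + (k + 1) * N = (n₀ + N) + k * N := by ring
    have hc : k = 0 ∨ gapWord b (fun i => f (n₀ + N + i)) N = gapWord b (fun i => f (n₀ + i)) N := by
      rcases Nat.eq_zero_or_pos k with hk | hk
      · exact Or.inl hk
      · refine Or.inr (gapWord_congr fun i h1 h2 => ?_)
        have : 1 * N ≤ k * N := Nat.mul_le_mul_right _ hk
        rw [h (n₀ + i) (by omega) (by omega), add_right_comm]
    rw [e, ih fun i h1 h2 => h i (by omega) (by omega), gapWord_add, List.replicate_succ,
      List.flatten_cons, List.append_assoc]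
    rcases hc with rfl | hc
    · simp
    · rw [hc]

/-! ### Valuations and periodicity of the ruler sequence -/

theorem pow_dvd_iff_le_ordb {c n z : ℕ} (hc : 2 ≤ c) (hn : 1 ≤ n) : c ^ z ∣ n ↔ z ≤ ordb c n := by
  have hbdd : BddAbove {z | c ^ z ∣ n} :=
    ⟨n, fun z hz => (Nat.lt_pow_self hc).le.trans (Nat.le_of_dvd hn hz)⟩
  refine ⟨fun h => le_csSup hbdd h, fun h => (pow_dvd_pow c h).trans ?_⟩
  exact Nat.sSup_mem (s := {z | c ^ z ∣ n}) ⟨0, by simp⟩ hbdd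

theorem pow_ordb_dvd {c n : ℕ} (hc : 2 ≤ c) (hn : 1 ≤ n) : c ^ ordb c n ∣ n :=
  (pow_dvd_iff_le_ordb hc hn).2 le_rfl

theorem ordb_eq_iff {c n z : ℕ} (hc : 2 ≤ c) (hn : 1 ≤ n) :
    ordb c n = z ↔ c ^ z ∣ n ∧ ¬c ^ (z + 1) ∣ n := by
  rw [pow_dvd_iff_le_ordb hc hn, pow_dvd_iff_le_ordb hc hn]
  omega

theorem ordb_eq_zero {c n : ℕ} (hc : 2 ≤ c) (h : ¬c ∣ n) : ordb c n = 0 := by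
  have hn : 1 ≤ n := by
    rcases Nat.eq_zero_or_pos n with rfl | hn
    · simp at h
    · exact hn
  rw [ordb_eq_iff hc hn]
  simpa using h

theorem ordb_mul_pow {c y r : ℕ} (hc : 2 ≤ c) (hy : ¬c ∣ y) : ordb c (y * c ^ r) = r := by
  have hy0 : 1 ≤ y := by
    rcases Nat.eq_zero_or_pos y with rfl | hn
    · simp at hy
    · exact hn
  have hp : 0 < c ^ r := by positivity
  rw [ordb_eq_iff hc (Nat.mul_pos hy0 hp)]
  refine ⟨Dvd.intro_left y rfl, fun h => hy ?_⟩
  rw [pow_succ, mul_comm] at h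
  exact Nat.dvd_of_mul_dvd_mul_right hp (by simpa [mul_comm] using h)

/-- Adding a multiple of a higher power of `c` does not change the valuation. -/
theorem ordb_add_of_dvd {c i n r : ℕ} (hc : 2 ≤ c) (hi : 1 ≤ i) (hr : ¬c ^ r ∣ i)
    (hn : c ^ r ∣ n) : ordb c (n + i) = ordb c i := by
  have hlt : ordb c i < r := by
    by_contra h
    exact hr ((pow_dvd_iff_le_ordb hc hi).2 (by omega))
  have h1 : c ^ (ordb c i + 1) ∣ n := (pow_dvd_pow c (by omega)).trans hn
  rw [ordb_eq_iff hc (by omega)]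
  refine ⟨dvd_add ((pow_dvd_pow c (by omega)).trans h1) (pow_ordb_dvd hc hi), fun h => ?_⟩
  exact ((ordb_eq_iff hc hi).1 rfl).2 ((Nat.dvd_add_right h1).1 h)

theorem not_pow_dvd_of_ordb_periodic {c n₀ M N : ℕ} (hc : 2 ≤ c) (hN : 1 ≤ N)
    (hper : ∀ i, n₀ < i → i + N ≤ M → ordb c i = ordb c (i + N)) (hM : n₀ + 2 * N ≤ M) :
    ∀ i, n₀ < i → i ≤ M → ¬c ^ (ordb c N + 1) ∣ i := by
  intro i h1 h2 hd
  have hNn : ¬c ^ (ordb c N + 1) ∣ N := ((ordb_eq_iff hc hN).1 rfl).2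
  rcases Nat.lt_or_ge M (i + N) with h | h
  · obtain ⟨l, rfl⟩ : ∃ l, i = l + N := ⟨i - N, by omega⟩
    have := hper l (by omega) h2
    have hl : c ^ (ordb c N + 1) ∣ l := by
      rw [pow_dvd_iff_le_ordb hc (by omega), this, ← pow_dvd_iff_le_ordb hc (by omega)]
      exact hd
    exact hNn ((Nat.dvd_add_right hl).1 hd)
  · have hl : c ^ (ordb c N + 1) ∣ i + N := by
      rw [pow_dvd_iff_le_ordb hc (by omega), ← hper i h1 h, ← pow_dvd_iff_le_ordb hc (by omega)]
      exact hd
    exact hNn ((Nat.dvd_add_right hd).1 hl)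

theorem lt_add_of_forall_not_dvd {d n₀ M : ℕ} (hd : 0 < d)
    (h : ∀ i, n₀ < i → i ≤ M → ¬d ∣ i) : M < n₀ + d := by
  by_contra hM
  have h1 := Nat.div_add_mod n₀ d
  have h2 := Nat.mod_lt n₀ hd
  have h3 : d * (n₀ / d + 1) = d * (n₀ / d) + d := by ring
  exact h (d * (n₀ / d + 1)) (by omega) (by omega) (dvd_mul_right _ _)

/-! ### Words built from a system of glue strings -/

/-- A strictly increasing chain of prefixes starting from the empty word, avoiding the letter `b`
and with curling numbers at most `b`. -/
structure GlueSystem (b : ℕ) (T : ℕ → List ℕ) : Prop where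
  one_le : 1 ≤ b
  zero : T 0 = []
  not_mem : ∀ j, b ∉ T j
  isPrefix : ∀ i j, i ≤ j → T i <+: T j
  length_lt : ∀ i j, i < j → (T i).length < (T j).length
  curl_le : ∀ j, curl (T j) ≤ b

/-- The word `b T(ord 1) b T(ord 2) ⋯ b T(ord x)`, with valuations in base `b + 1`. -/
noncomputable def rulerWord (b : ℕ) (T : ℕ → List ℕ) (x : ℕ) : List ℕ :=
  gapWord b (fun i => T (ordb (b + 1) i)) x

theorem le_curl_of_not_mem {b k : ℕ} {A U X Y : List ℕ} (hY : Y ≠ []) (hb : b ∉ Y)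
    (e : A ++ b :: U = X ++ (List.replicate k Y).flatten) : k ≤ curl U := by
  have hb' : b ∉ (List.replicate k Y).flatten := by
    simp only [List.mem_flatten, List.mem_replicate, not_exists, not_and, and_imp]
    rintro l - rfl
    exact hb
  obtain ⟨V, hV⟩ := suffix_of_append_eq hb' e.symm
  exact le_curl hY hV.symm

namespace GlueSystem

variable {b : ℕ} {T : ℕ → List ℕ}

theorem injective (hT : GlueSystem b T) {i j : ℕ} (h : T i = T j) : i = j := by
  rcases lt_trichotomy i j with hij | hij | hij
  · have := hT.length_lt i j hij
    rw [h] at this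
    omega
  · exact hij
  · have := hT.length_lt j i hij
    rw [h] at this
    omega

theorem lt_of_eq_append (hT : GlueSystem b T) {i j : ℕ} {h : List ℕ} (hh : h ≠ [])
    (e : T j = T i ++ h) : i < j := by
  by_contra hij
  have h1 := (hT.isPrefix j i (by omega)).length_le
  have h2 := List.length_pos_iff.2 hh
  rw [e, List.length_append] at h1
  omega

theorem eq_nil_iff (hT : GlueSystem b T) {i : ℕ} : T i = [] ↔ i = 0 :=
  ⟨fun h => hT.injective (h.trans hT.zero.symm), fun h => h ▸ hT.zero⟩

/-- The gaps are periodic with period `N` on `(n₀, n₀ + k N)` if a `k`-th power is a suffix. -/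
theorem exists_period (hT : GlueSystem b T) {x k : ℕ} {U X Y : List ℕ} (hU : b ∉ U)
    (hk : 1 ≤ k) (hY : b ∈ Y)
    (e : rulerWord b T x ++ b :: U = X ++ (List.replicate k Y).flatten) :
    ∃ h N n₀, b ∉ h ∧ 1 ≤ N ∧ x + 1 = n₀ + k * N ∧
      (∀ i, n₀ < i → i + N ≤ x → ordb (b + 1) i = ordb (b + 1) (i + N)) ∧
      (∀ j, 1 ≤ j → j < k → T (ordb (b + 1) (n₀ + j * N)) = U ++ h) ∧
      (h = [] ∨ 1 ≤ n₀ ∧ h <:+ T (ordb (b + 1) n₀)) := by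
  set f : ℕ → List ℕ := Function.update (fun i => T (ordb (b + 1) i)) (x + 1) U with hf
  have hfx : f (x + 1) = U := by simp [hf]
  have hfi : ∀ i, i ≠ x + 1 → f i = T (ordb (b + 1) i) := fun i hi => by simp [hf, hi]
  have hfb : ∀ i, b ∉ f i := by
    intro i
    rcases eq_or_ne i (x + 1) with rfl | hi
    · rwa [hfx]
    · rw [hfi i hi]; exact hT.not_mem _
  have e' : gapWord b f (x + 1) = X ++ (List.replicate k Y).flatten := by
    rw [gapWord, hfx, ← e, rulerWord]
    congr 1
    exact gapWord_congr fun i _ hi => hfi i (by omega)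
  obtain ⟨h, N, n₀, h1, h2, h3, h4, h5, h6⟩ := gapWord_periodic hfb (by omega) hk hY e'
  have hkN : 1 * N ≤ k * N := Nat.mul_le_mul_right _ hk
  refine ⟨h, N, n₀, h1, h2, h3, fun i hi hi' => ?_, fun j hj hj' => ?_, ?_⟩
  · have := h4 i hi (by omega)
    rw [hfi i (by omega), hfi (i + N) (by omega)] at this
    exact hT.injective this
  · have hlt : j * N < k * N := Nat.mul_lt_mul_of_pos_right hj' h2
    have := h5 j hj hj'
    rwa [hfx, hfi _ (by omega)] at this
  · rwa [hfi n₀ (by omega)] at h6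

theorem exponent_le (hT : GlueSystem b T) {x k : ℕ} {U X Y : List ℕ} (hU : b ∉ U) (hY : b ∈ Y)
    (e : rulerWord b T x ++ b :: U = X ++ (List.replicate k Y).flatten) : k ≤ b + 1 := by
  have hb := hT.one_le
  by_contra hk
  obtain ⟨h, N, n₀, -, h2, h3, h4, -, -⟩ := hT.exists_period hU (by omega) hY e
  have h5 : (b + 2) * N ≤ k * N := Nat.mul_le_mul_right _ (by omega)
  have h6 : 3 * N ≤ (b + 2) * N := Nat.mul_le_mul_right _ (by omega)
  have h7 := lt_add_of_forall_not_dvd (by positivity)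
    (not_pow_dvd_of_ordb_periodic (c := b + 1) (by omega) h2 h4 (by omega))
  have h8 := Nat.le_of_dvd h2 (pow_ordb_dvd (c := b + 1) (by omega) h2)
  rw [pow_succ] at h7
  have h9 : (b + 1) ^ ordb (b + 1) N * (b + 1) ≤ N * (b + 1) := Nat.mul_le_mul_right _ h8
  nlinarith

theorem curl_rulerWord_append_le (hT : GlueSystem b T) {x : ℕ} {U : List ℕ} (hU : b ∉ U) :
    curl (rulerWord b T x ++ b :: U) ≤ max (b + 1) (curl U) := by
  refine _root_.curl_le (le_max_of_le_left (by omega)) fun k X Y hY e => ?_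
  by_cases hb : b ∈ Y
  · exact le_max_of_le_left (hT.exponent_le hU hb e)
  · exact le_max_of_le_right (le_curl_of_not_mem hY hb e)

theorem curl_rulerWord_le (hT : GlueSystem b T) (x : ℕ) : curl (rulerWord b T x) ≤ b := by
  have hb := hT.one_le
  have hc : 2 ≤ b + 1 := by omega
  cases x with
  | zero => exact curl_nil.trans_le hb
  | succ x =>
  refine _root_.curl_le hb fun k X Y hY e => ?_
  change rulerWord b T x ++ b :: T (ordb (b + 1) (x + 1)) = _ at e
  by_cases hbY : b ∈ Y
  swap
  · exact (le_curl_of_not_mem hY hbY e).trans (hT.curl_le _)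
  have hk := hT.exponent_le (hT.not_mem _) hbY e
  by_contra hk'
  obtain rfl : k = b + 1 := by omega
  obtain ⟨h, N, n₀, -, h2, h3, h4, h5, h6⟩ :=
    hT.exists_period (hT.not_mem _) (by omega) hbY e
  have e1 : n₀ + b * N + N = x + 1 := by rw [h3]; ring
  have h7 := h5 b hb (by omega)
  have hbN : 1 * N ≤ b * N := Nat.mul_le_mul_right _ hb
  by_cases hh : h = []
  · have h8 : ∀ i, n₀ < i → i + N ≤ x + 1 → ordb (b + 1) i = ordb (b + 1) (i + N) := by
      intro i hi hi'
      rcases Nat.lt_or_ge x (i + N) with h9 | h9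
      · obtain rfl : i = n₀ + b * N := by omega
        rw [hh, List.append_nil] at h7
        rw [e1]
        exact hT.injective h7
      · exact h4 i hi h9
    have h9 := lt_add_of_forall_not_dvd (by positivity)
      (not_pow_dvd_of_ordb_periodic hc h2 h8 (by omega))
    have h10 := Nat.le_of_dvd h2 (pow_ordb_dvd hc h2)
    rw [pow_succ] at h9
    have : (b + 1) ^ ordb (b + 1) N * (b + 1) ≤ N * (b + 1) := Nat.mul_le_mul_right _ h10
    nlinarith
  · have hj := hT.lt_of_eq_append hh h7
    set j := ordb (b + 1) (x + 1) with hjdef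
    have hx : ¬(b + 1) ^ (j + 1) ∣ x + 1 := ((ordb_eq_iff hc (by omega)).1 hjdef.symm).2
    have hx' : (b + 1) ^ j ∣ x + 1 := pow_ordb_dvd hc (by omega)
    have hl : (b + 1) ^ (j + 1) ∣ n₀ + b * N := (pow_dvd_iff_le_ordb hc (by omega)).2 hj
    rcases Nat.lt_or_ge b 2 with hb2 | hb2
    · obtain rfl : b = 1 := by omega
      obtain ⟨h8, h9⟩ := h6.resolve_left hh
      have hn1 : ¬(1 + 1) ^ (j + 1) ∣ N := fun hd => hx (e1 ▸ dvd_add hl hd)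
      have hn2 : (1 + 1) ^ j ∣ N := by
        rw [← e1] at hx'
        exact (Nat.dvd_add_right ((pow_dvd_pow _ (Nat.le_succ j)).trans hl)).1 hx'
      have hn0 : ordb (1 + 1) n₀ = j := by
        rw [ordb_eq_iff hc h8]
        constructor
        · have h10 := (pow_dvd_pow (1 + 1) (Nat.le_succ j)).trans hl
          rw [one_mul] at h10
          exact (Nat.dvd_add_left hn2).1 h10
        · intro hd
          rw [one_mul] at hl
          exact hn1 ((Nat.dvd_add_right hd).1 hl)
      rw [hn0] at h9
      have h10 := two_le_curl hh h9
      have h11 := hT.curl_le (ordb (1 + 1) (n₀ + 1 * N))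
      rw [h7] at h11
      omega
    · have h8 := not_pow_dvd_of_ordb_periodic hc h2 h4 (by nlinarith)
        (n₀ + b * N) (by omega) (by omega)
      have h9 : j + 1 ≤ ordb (b + 1) N := by
        by_contra hcon
        exact h8 ((pow_dvd_pow _ (by omega)).trans hl)
      exact hx (e1 ▸ dvd_add hl ((pow_dvd_iff_le_ordb hc h2).2 h9))

/-- Words whose last complete block is followed by a shorter glue string have a large curling
number. -/
theorem le_curl_rulerWord_append (hT : GlueSystem b T) {x i : ℕ} (hi : i < ordb (b + 1) (x + 1)) :
    b + 1 ≤ curl (rulerWord b T x ++ b :: T i) := by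
  have hb := hT.one_le
  have hc : 2 ≤ b + 1 := by omega
  set c := b + 1
  set f : ℕ → List ℕ := Function.update (fun i => T (ordb c i)) (x + 1) (T i) with hf
  have hfx : f (x + 1) = T i := by simp [hf]
  have hfi : ∀ l, l ≠ x + 1 → f l = T (ordb c l) := fun i hi => by simp [hf, hi]
  have e : rulerWord b T x ++ b :: T i = gapWord b f (x + 1) := by
    rw [gapWord, hfx, rulerWord]
    congr 1
    exact gapWord_congr fun l _ hl => (hfi l (by omega)).symm
  have hd : c ^ (i + 1) ∣ x + 1 := (pow_dvd_iff_le_ordb hc (by omega)).2 hi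
  obtain ⟨n₀, hn₀⟩ : ∃ n₀, x + 1 = n₀ + c * c ^ i := by
    refine ⟨x + 1 - c * c ^ i, ?_⟩
    have := Nat.le_of_dvd (by omega) hd
    rw [pow_succ'] at this
    omega
  have hd₀ : c ^ (i + 1) ∣ n₀ := by
    rw [hn₀, ← pow_succ'] at hd
    exact (Nat.dvd_add_left dvd_rfl).1 hd
  have hp : 0 < c ^ i := by positivity
  rw [e, hn₀, gapWord_eq_power (N := c ^ i)]
  · refine le_curl ?_ rfl
    obtain ⟨l, hl⟩ : ∃ l, c ^ i = l + 1 := ⟨c ^ i - 1, by omega⟩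
    rw [hl, gapWord]
    simp
  · intro l h1 h2
    have hlow : ∀ l, n₀ < l → l < x + 1 → c ^ i ∣ l → T (ordb c l) = T i := by
      intro l h1 h2 h3
      rw [(ordb_eq_iff hc (by omega)).2 ⟨h3, fun h4 => ?_⟩]
      have h5 := (Nat.dvd_sub h4 hd₀)
      have h6 := Nat.le_of_dvd (by omega) h5
      rw [pow_succ'] at h6
      omega
    rw [hfi l (by omega)]
    by_cases hdl : c ^ i ∣ l
    · rw [hlow l h1 (by omega) hdl]
      rcases eq_or_ne (l + c ^ i) (x + 1) with h3 | h3
      · rw [h3, hfx]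
      · rw [hfi _ h3, hlow _ (by omega) (by omega) (dvd_add hdl dvd_rfl)]
    · rw [hfi, add_comm l, ordb_add_of_dvd hc (by omega) hdl dvd_rfl]
      intro h3
      refine hdl ((Nat.dvd_add_left dvd_rfl).1 (h3 ▸ ?_))
      exact (pow_dvd_pow c (Nat.le_succ i)).trans hd

/-- A digit `b` in the base-`(b+1)` expansion of `x` forces curling number at least `b`. -/
theorem le_curl_rulerWord_of_digit (hT : GlueSystem b T) {x w : ℕ}
    (h : x / (b + 1) ^ w % (b + 1) = b) : b ≤ curl (rulerWord b T x) := by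
  have hb := hT.one_le
  have hc : 2 ≤ b + 1 := by omega
  set c := b + 1
  have hp : 0 < c ^ w := by positivity
  set q := x / c ^ w / c
  set r := x % c ^ w
  have hr : r < c ^ w := Nat.mod_lt _ hp
  have hx : x = q * c ^ (w + 1) + r + b * c ^ w := by
    have h1 := Nat.div_add_mod x (c ^ w)
    have h2 := Nat.div_add_mod (x / c ^ w) c
    rw [h] at h2
    rw [← h1, ← h2]
    ring
  rw [rulerWord, hx, gapWord_eq_power (N := c ^ w)]
  · refine le_curl ?_ rfl
    obtain ⟨l, hl⟩ : ∃ l, c ^ w = l + 1 := ⟨c ^ w - 1, by omega⟩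
    rw [hl, gapWord]
    simp
  · intro l h1 h2
    congr 1
    by_cases hdl : c ^ w ∣ l
    · have h3 : c ^ (w + 1) = b * c ^ w + c ^ w := by rw [pow_succ]; ring
      have hlow : ∀ l, q * c ^ (w + 1) < l → l < q * c ^ (w + 1) + c ^ (w + 1) → c ^ w ∣ l →
          ordb c l = w := by
        intro l h1 h2 h3
        rw [ordb_eq_iff hc (by omega)]
        refine ⟨h3, fun h4 => ?_⟩
        have h5 := Nat.dvd_sub h4 (Dvd.intro_left q rfl : c ^ (w + 1) ∣ q * c ^ (w + 1))
        have h6 := Nat.le_of_dvd (by omega) h5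
        omega
      clear_value q r
      generalize c ^ (w + 1) = C at *
      rw [hlow l (by omega) (by omega) hdl, hlow _ (by omega) (by omega) (dvd_add hdl dvd_rfl)]
    · rw [add_comm l, ordb_add_of_dvd hc (Nat.zero_lt_of_lt h1) hdl dvd_rfl]

/-- If `b + 1` does not divide `x` and no base-`(b+1)` digit of `x` is `b`, then the curling number
is less than `b`. -/
theorem curl_rulerWord_lt (hT : GlueSystem b T) (hb : 2 ≤ b) {x : ℕ} (hx : ¬(b + 1) ∣ x)
    (hdig : ∀ w, x / (b + 1) ^ w % (b + 1) ≠ b) : curl (rulerWord b T x) ≤ b - 1 := by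
  have hc : 2 ≤ b + 1 := by omega
  cases x with
  | zero => simp at hx
  | succ x =>
  refine _root_.curl_le (by omega) fun k X Y hY e => ?_
  change rulerWord b T x ++ b :: T (ordb (b + 1) (x + 1)) = _ at e
  rw [ordb_eq_zero hc hx, hT.zero] at e
  by_cases hbY : b ∈ Y
  swap
  · have := le_curl_of_not_mem hY hbY e
    rw [curl_nil] at this
    omega
  by_contra hk'
  obtain ⟨l, rfl⟩ : ∃ l, k = l + b := ⟨k - b, by omega⟩
  rw [List.replicate_add, List.flatten_append, ← List.append_assoc] at e
  obtain ⟨h, N, n₀, -, h2, h3, h4, h5, h6⟩ :=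
    hT.exists_period (by simp) (by omega) hbY e
  simp only [List.nil_append] at h5
  have hbN : 2 * N ≤ b * N := Nat.mul_le_mul_right _ hb
  by_cases hh : h = []
  · have e1 : n₀ + (b - 1) * N + N = x + 1 := by
      obtain ⟨d, rfl⟩ : ∃ d, b = d + 1 := ⟨b - 1, by omega⟩
      rw [h3, Nat.add_sub_cancel]; ring
    have h8 : ∀ i, n₀ < i → i + N ≤ x + 1 → ordb (b + 1) i = ordb (b + 1) (i + N) := by
      intro i hi hi'
      rcases Nat.lt_or_ge x (i + N) with h9 | h9
      · obtain rfl : i = n₀ + (b - 1) * N := by omega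
        rw [e1, ordb_eq_zero hc hx]
        exact hT.eq_nil_iff.1 ((h5 (b - 1) (by omega) (by omega)).trans hh)
      · exact h4 i hi h9
    have h9 := not_pow_dvd_of_ordb_periodic hc h2 h8 (by omega)
    have h10 := lt_add_of_forall_not_dvd (by positivity) h9
    obtain ⟨d, hd⟩ := pow_ordb_dvd hc h2
    set w := ordb (b + 1) N
    have hp : 0 < (b + 1) ^ w := by positivity
    have hd1 : d = 1 := by
      rcases d with _ | _ | d
      · omega
      · rfl
      · rw [pow_succ, h3] at h10
        have : (b + 1) ^ w * 2 ≤ N := by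
          rw [hd]; exact Nat.mul_le_mul_left _ (by omega)
        have := Nat.mul_le_mul_left b this
        nlinarith
    rw [hd1, mul_one] at hd
    refine _root_.absurd ?_ (hdig w)
    have h11 := Nat.div_add_mod (x + 1) ((b + 1) ^ w)
    have h12 := Nat.mod_lt (x + 1) hp
    have h13 := Nat.div_add_mod ((x + 1) / (b + 1) ^ w) (b + 1)
    have h14 := Nat.mod_lt ((x + 1) / (b + 1) ^ w) (show 0 < b + 1 by omega)
    set q := (x + 1) / (b + 1) ^ w / (b + 1)
    set s := (x + 1) / (b + 1) ^ w % (b + 1)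
    by_contra hs
    have h15 : (b + 1) ^ w * ((x + 1) / (b + 1) ^ w) = (b + 1) ^ (w + 1) * q + s * (b + 1) ^ w := by
      rw [← h13, pow_succ]; ring
    have h16 : (s + 1) * (b + 1) ^ w ≤ b * (b + 1) ^ w := Nat.mul_le_mul_right _ (by omega)
    have h17 : (s + 1) * (b + 1) ^ w = s * (b + 1) ^ w + (b + 1) ^ w := by ring
    rw [← hd] at h11 h12 h15 h16 h17
    set C := (b + 1) ^ (w + 1)
    exact h9 (C * q) (by omega) (by omega) (dvd_mul_right _ _)
  · obtain ⟨h7, h8⟩ := h6.resolve_left hh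
    have h9 := h5 1 le_rfl (by omega)
    rw [one_mul] at h9
    have h10 : b + 1 ∣ n₀ := by
      by_contra hcon
      rw [ordb_eq_zero hc hcon, hT.zero] at h8
      exact hh (List.eq_nil_of_suffix_nil h8)
    have h11 : b + 1 ∣ n₀ + N := by
      by_contra hcon
      rw [ordb_eq_zero hc hcon, hT.zero] at h9
      exact hh h9.symm
    exact hx (h3 ▸ dvd_add h10 (((Nat.dvd_add_right h10).1 h11).mul_left b))

end GlueSystem

/-! ### The structure of Gijswijt sequences -/

theorem length_gPrefix (m n : ℕ) : (gPrefix m n).length = n := by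
  induction n with
  | zero => rfl
  | succ n ih => simp [gPrefix, ih]

theorem gPrefix_isPrefix {m i j : ℕ} (h : i ≤ j) : gPrefix m i <+: gPrefix m j := by
  induction j, h using Nat.le_induction with
  | base => exact List.prefix_rfl
  | succ j _ ih => exact ih.trans (List.prefix_append _ _)

theorem le_of_mem_gPrefix {m n a : ℕ} (h : a ∈ gPrefix m n) : m ≤ a := by
  induction n with
  | zero => simp [gPrefix] at h
  | succ n ih =>
    rw [gPrefix, List.mem_append, List.mem_singleton] at h
    rcases h with h | rfl
    · exact ih h
    · exact le_max_left _ _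

theorem not_mem_gPrefix_succ (b n : ℕ) : b ∉ gPrefix (b + 1) n := fun h => by
  have := le_of_mem_gPrefix h
  omega

theorem nth_eq_of_strictMono {p : ℕ → Prop} {f : ℕ → ℕ} (hf : StrictMono f)
    (hp : ∀ k, p k ↔ ∃ n, f n = k) (n : ℕ) : Nat.nth p n = f n := by
  have hinf : {k | p k}.Infinite :=
    (Set.infinite_range_of_injective hf.injective).mono fun k hk => (hp k).2 hk
  rw [← Nat.nth_comp_of_strictMono hf (fun k hk => (hp k).1 hk) fun h => absurd h hinf,
    Nat.nth_of_forall]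
  exact fun i _ => (hp _).2 ⟨i, rfl⟩

/-- The chain of prefixes `T_1, T_2, …` of `A^(b+1)`, indexed from `0`. -/
noncomputable def glueChain (b j : ℕ) : List ℕ := Tstr b (j + 1)

section Structure

variable {b : ℕ}

theorem tau_one (hb : 1 ≤ b) : tau b 1 = 0 :=
  Nat.nth_zero_of_zero (show curl (gPrefix (b + 1) 0) ≤ b from curl_nil.trans_le hb)

theorem strictMono_tau (hinf : {k | curl (gPrefix (b + 1) k) ≤ b}.Infinite) :
    StrictMono fun j => tau b (j + 1) :=
  Nat.nth_strictMono hinf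

theorem exists_tau_eq {k : ℕ} (h : curl (gPrefix (b + 1) k) ≤ b) : ∃ j, tau b (j + 1) = k :=
  ⟨_, Nat.nth_count (p := fun k => curl (gPrefix (b + 1) k) ≤ b) h⟩

theorem glueSystem_glueChain (hb : 1 ≤ b)
    (hinf : {k | curl (gPrefix (b + 1) k) ≤ b}.Infinite) : GlueSystem b (glueChain b) where
  one_le := hb
  zero := by rw [glueChain, Tstr, tau_one hb]; rfl
  not_mem j := not_mem_gPrefix_succ b _
  isPrefix i j h := gPrefix_isPrefix ((strictMono_tau hinf).monotone h)
  length_lt i j h := by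
    simp only [glueChain, Tstr, length_gPrefix]
    exact strictMono_tau hinf h
  curl_le j := Nat.nth_mem_of_infinite (p := fun k => curl (gPrefix (b + 1) k) ≤ b) hinf j

theorem curl_rulerWord_append_gPrefix (hb : 1 ≤ b)
    (hinf : {k | curl (gPrefix (b + 1) k) ≤ b}.Infinite) {x s : ℕ}
    (hs : s < tau b (ordb (b + 1) (x + 1) + 1)) :
    curl (rulerWord b (glueChain b) x ++ b :: gPrefix (b + 1) s) =
      max (b + 1) (curl (gPrefix (b + 1) s)) := by
  have hT := glueSystem_glueChain hb hinf
  have h1 : curl (gPrefix (b + 1) s) ≤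
      curl (rulerWord b (glueChain b) x ++ b :: gPrefix (b + 1) s) := by
    simpa using curl_le_curl_append (rulerWord b (glueChain b) x ++ [b]) (gPrefix (b + 1) s)
  refine le_antisymm (hT.curl_rulerWord_append_le (not_mem_gPrefix_succ b s)) (max_le ?_ h1)
  rcases Nat.lt_or_ge b (curl (gPrefix (b + 1) s)) with h | h
  · omega
  · obtain ⟨i, rfl⟩ := exists_tau_eq h
    exact hT.le_curl_rulerWord_append ((strictMono_tau hinf).lt_iff_lt.1 hs)

theorem gPrefix_eq_rulerWord_append (hb : 1 ≤ b)
    (hinf : {k | curl (gPrefix (b + 1) k) ≤ b}.Infinite) {x L s : ℕ}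
    (hx : gPrefix b L = rulerWord b (glueChain b) x)
    (hs : s ≤ tau b (ordb (b + 1) (x + 1) + 1)) :
    gPrefix b (L + 1 + s) = rulerWord b (glueChain b) x ++ b :: gPrefix (b + 1) s := by
  have hT := glueSystem_glueChain hb hinf
  induction s with
  | zero =>
    rw [add_zero, gPrefix.eq_2, hx, max_eq_left (hT.curl_rulerWord_le x)]
    rfl
  | succ s ih =>
    rw [← add_assoc, gPrefix, ih (by omega),
      curl_rulerWord_append_gPrefix hb hinf (by omega), gPrefix, ← max_assoc,
      max_eq_right (show b ≤ b + 1 by omega)]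
    simp

theorem rulerWord_eq_gPrefix (hb : 1 ≤ b)
    (hinf : {k | curl (gPrefix (b + 1) k) ≤ b}.Infinite) (x : ℕ) :
    gPrefix b (rulerWord b (glueChain b) x).length = rulerWord b (glueChain b) x := by
  induction x with
  | zero => rfl
  | succ x ih =>
    have h := gPrefix_eq_rulerWord_append hb hinf ih le_rfl
    change _ = rulerWord b (glueChain b) (x + 1) at h
    rw [← h, length_gPrefix]

theorem strictMono_length_rulerWord (T : ℕ → List ℕ) :
    StrictMono fun x => (rulerWord b T x).length := by
  refine strictMono_nat_of_lt_succ fun x => ?_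
  simp only [rulerWord, gapWord, List.length_append, List.length_cons]
  omega

theorem exists_rulerWord_eq (hb : 1 ≤ b)
    (hinf : {k | curl (gPrefix (b + 1) k) ≤ b}.Infinite) {k : ℕ} (hk : curl (gPrefix b k) ≤ b) :
    ∃ x, (rulerWord b (glueChain b) x).length = k := by
  have hmono := strictMono_length_rulerWord (b := b) (glueChain b)
  have hex : ∃ x, k < (rulerWord b (glueChain b) x).length :=
    ⟨k + 1, lt_of_lt_of_le (Nat.lt_succ_self k) (hmono.id_le _)⟩
  obtain ⟨x, hx⟩ : ∃ x, Nat.find hex = x + 1 := by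
    refine Nat.exists_eq_add_one.2 (Nat.pos_of_ne_zero fun h => ?_)
    have := Nat.find_spec hex
    rw [h] at this
    simp [rulerWord, gapWord] at this
  have h1 : k < (rulerWord b (glueChain b) (x + 1)).length := hx ▸ Nat.find_spec hex
  have h2 := Nat.find_min hex (m := x) (by omega)
  refine ⟨x, ?_⟩
  by_contra hne
  have h3 := rulerWord_eq_gPrefix hb hinf x
  obtain ⟨s, rfl⟩ : ∃ s, k = (rulerWord b (glueChain b) x).length + 1 + s :=
    ⟨k - ((rulerWord b (glueChain b) x).length + 1), by omega⟩
  have hs : s < tau b (ordb (b + 1) (x + 1) + 1) := by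
    change _ < (rulerWord b (glueChain b) x ++ b :: glueChain b (ordb (b + 1) (x + 1))).length at h1
    rw [List.length_append, List.length_cons, glueChain, Tstr, length_gPrefix] at h1
    omega
  rw [gPrefix_eq_rulerWord_append hb hinf h3 hs.le,
    curl_rulerWord_append_gPrefix hb hinf hs] at hk
  have := (le_max_left _ _).trans hk
  omega

theorem piStr_eq_rulerWord (hb : 1 ≤ b)
    (hinf : {k | curl (gPrefix (b + 1) k) ≤ b}.Infinite) (x : ℕ) :
    piStr b x = rulerWord b (glueChain b) x := by
  have hT := glueSystem_glueChain hb hinf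
  rw [piStr, piLen, nth_eq_of_strictMono (strictMono_length_rulerWord (b := b) (glueChain b)),
    rulerWord_eq_gPrefix hb hinf]
  refine fun k => ⟨fun hk => exists_rulerWord_eq hb hinf hk, ?_⟩
  rintro ⟨n, rfl⟩
  rw [rulerWord_eq_gPrefix hb hinf]
  exact hT.curl_rulerWord_le n

/-- Gap words multiply over blocks of length `(b+1)^r`. -/
theorem rulerWord_mul_pow_add (hb : 1 ≤ b) {T : ℕ → List ℕ} {z r i : ℕ} (hi : i < (b + 1) ^ r) :
    rulerWord b T (z * (b + 1) ^ r + i) = rulerWord b T (z * (b + 1) ^ r) ++ rulerWord b T i := by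
  rw [rulerWord, gapWord_add]
  congr 1
  refine gapWord_congr fun l h1 h2 => ?_
  rw [ordb_add_of_dvd (by omega) h1 (fun h => ?_) (Dvd.intro_left z rfl)]
  have := Nat.le_of_dvd h1 h
  omega

theorem glueChain_succ (hinf : {k | curl (gPrefix (b + 1) k) ≤ b}.Infinite) (r : ℕ) :
    glueChain b (r + 1) = glueChain b r ++ glue b (r + 1) := by
  obtain ⟨S, hS⟩ : Tstr b (r + 1) <+: Tstr b (r + 2) :=
    gPrefix_isPrefix ((strictMono_tau hinf).monotone (Nat.le_succ r))
  have h : glue b (r + 1) = S := by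
    change (Tstr b (r + 2)).drop (tau b (r + 1)) = S
    rw [← hS, List.drop_left']
    rw [Tstr, length_gPrefix]
  rw [h]
  exact hS.symm

theorem rulerWord_mul_pow_succ (hb : 1 ≤ b)
    (hinf : {k | curl (gPrefix (b + 1) k) ≤ b}.Infinite) {y r : ℕ} (hy : ¬(b + 1) ∣ y + 1) :
    rulerWord b (glueChain b) ((y + 1) * (b + 1) ^ (r + 1)) =
      rulerWord b (glueChain b) ((y * (b + 1) + b) * (b + 1) ^ r) ++
        rulerWord b (glueChain b) ((b + 1) ^ r) ++ glue b (r + 1) := by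
  have hc : 2 ≤ b + 1 := by omega
  obtain ⟨l, hl⟩ : ∃ l, (b + 1) ^ r = l + 1 :=
    ⟨(b + 1) ^ r - 1, by have : 0 < (b + 1) ^ r := by positivity
                         omega⟩
  have e : (y + 1) * (b + 1) ^ (r + 1) = (y * (b + 1) + b) * (b + 1) ^ r + l + 1 := by
    rw [add_assoc, ← hl]; ring
  have h1 : ordb (b + 1) ((y + 1) * (b + 1) ^ (r + 1)) = r + 1 := ordb_mul_pow hc hy
  have h2 : ordb (b + 1) (l + 1) = r := by
    rw [← hl, ← one_mul ((b + 1) ^ r), ordb_mul_pow hc]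
    intro h
    have := Nat.le_of_dvd one_pos h
    omega
  have h3 : rulerWord b (glueChain b) ((b + 1) ^ r) =
      rulerWord b (glueChain b) l ++ b :: glueChain b r := by
    rw [hl, ← h2]; rfl
  have h4 : rulerWord b (glueChain b) ((y + 1) * (b + 1) ^ (r + 1)) =
      rulerWord b (glueChain b) ((y * (b + 1) + b) * (b + 1) ^ r + l) ++
        b :: glueChain b (r + 1) := by
    rw [e] at h1 ⊢
    rw [← h1]; rfl
  rw [h4, h3, rulerWord_mul_pow_add hb (by omega), glueChain_succ hinf]
  simp

/-- The integer `(b-1) + (b-1)(b+1) + ⋯ + (b-1)(b+1)^(r-1)`. -/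
def subRepunit (b : ℕ) : ℕ → ℕ
  | 0 => 0
  | r + 1 => (b - 1) * (b + 1) ^ r + subRepunit b r

theorem rulerWord_mul_pow_eq_append_Pstr (hb : 1 ≤ b)
    (hinf : {k | curl (gPrefix (b + 1) k) ≤ b}.Infinite) {y r : ℕ} (hy : ¬(b + 1) ∣ y + 1) :
    rulerWord b (glueChain b) ((y + 1) * (b + 1) ^ r) =
      rulerWord b (glueChain b) (y * (b + 1) ^ r + subRepunit b r) ++ Pstr b (r + 1) := by
  have hc : 2 ≤ b + 1 := by omega
  have hT := glueSystem_glueChain hb hinf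
  induction r generalizing y with
  | zero =>
    simp only [pow_zero, mul_one, subRepunit, add_zero, Pstr]
    change rulerWord b (glueChain b) y ++ b :: glueChain b (ordb (b + 1) (y + 1)) = _
    rw [ordb_eq_zero hc hy, hT.zero]
  | succ r ih =>
    have hy' : ¬(b + 1) ∣ (y * (b + 1) + (b - 1)) + 1 := by
      intro h
      have h1 := (Nat.dvd_add_right (Dvd.intro_left y rfl : b + 1 ∣ y * (b + 1))).1
        (by rwa [add_assoc] at h)
      have := Nat.le_of_dvd (by omega) h1
      omega
    have h := ih hy'
    rw [add_assoc, Nat.sub_add_cancel hb] at h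
    rw [rulerWord_mul_pow_succ hb hinf hy, h, Pstr, Bstr, piStr_eq_rulerWord hb hinf,
      Nat.add_sub_cancel, subRepunit]
    simp only [List.append_assoc]
    ring_nf

end Structure

/-! ### Rereading digits in another base -/

theorem ofDigits_digits_eq {p q : ℕ} (hq : 1 < q) (n : ℕ) :
    Nat.ofDigits p (Nat.digits q n) = n % q + p * Nat.ofDigits p (Nat.digits q (n / q)) := by
  rcases Nat.eq_zero_or_pos n with rfl | hn
  · simp
  · rw [Nat.digits_def' hq hn, Nat.ofDigits_cons]

section Digits

variable {b : ℕ}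

theorem chi_mod (hb : 2 ≤ b) (a : ℕ) : chi b a % (b + 1) = a % b := by
  rw [chi, ofDigits_digits_eq (by omega), Nat.add_mul_mod_self_left, Nat.mod_eq_of_lt]
  exact (Nat.mod_lt a (by omega)).trans (Nat.lt_succ_self b)

theorem chi_div (hb : 2 ≤ b) (a : ℕ) : chi b a / (b + 1) = chi b (a / b) := by
  rw [chi, ofDigits_digits_eq (by omega), Nat.add_mul_div_left _ _ (by omega),
    Nat.div_eq_of_lt ((Nat.mod_lt a (by omega)).trans (Nat.lt_succ_self b)), zero_add, chi]

theorem chi_mul_add (hb : 2 ≤ b) (q : ℕ) {d : ℕ} (hd : d < b) :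
    chi b (q * b + d) = chi b q * (b + 1) + d := by
  rw [← Nat.div_add_mod' (chi b (q * b + d)) (b + 1), chi_mod hb, chi_div hb, add_comm (q * b),
    Nat.add_mul_mod_self_right, Nat.mod_eq_of_lt hd, Nat.add_mul_div_right _ _ (by omega),
    Nat.div_eq_of_lt hd, zero_add]

theorem chi_digit_ne (hb : 2 ≤ b) (a w : ℕ) : chi b a / (b + 1) ^ w % (b + 1) ≠ b := by
  induction w generalizing a with
  | zero =>
    rw [pow_zero, Nat.div_one, chi_mod hb]
    exact (Nat.mod_lt _ (by omega)).ne
  | succ w ih =>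
    rw [pow_succ', ← Nat.div_div_eq_div_mul, chi_div hb]
    exact ih _

theorem strictMono_chi (hb : 2 ≤ b) : StrictMono (chi b) := by
  refine strictMono_nat_of_lt_succ fun a => ?_
  induction a using Nat.strong_induction_on with
  | _ a ih =>
    have h1 := Nat.div_add_mod' a b
    have h2 := Nat.mod_lt a (show 0 < b by omega)
    rcases Nat.lt_or_ge (a % b + 1) b with h | h
    · rw [← h1, add_assoc, chi_mul_add hb _ h2, chi_mul_add hb _ h]
      omega
    · have h3 : a + 1 = (a / b + 1) * b + 0 := by rw [add_mul]; omega
      have h4 : 0 < a := by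
        by_contra h0
        obtain rfl : a = 0 := by omega
        simp at h
        omega
      have h5 := ih (a / b) (Nat.div_lt_self h4 (by omega))
      have h6 : (chi b (a / b) + 1) * (b + 1) ≤ chi b (a / b + 1) * (b + 1) :=
        Nat.mul_le_mul_right _ h5
      rw [h3, chi_mul_add hb _ (by omega)]
      nth_rw 1 [← h1]
      rw [chi_mul_add hb _ h2]
      rw [add_mul] at h6
      omega

theorem ofDigits_digits_chi (hb : 2 ≤ b) (a : ℕ) :
    Nat.ofDigits b (Nat.digits (b + 1) (chi b a)) = a := by
  induction a using Nat.strong_induction_on with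
  | _ a ih =>
    rcases Nat.eq_zero_or_pos a with rfl | ha
    · simp [chi]
    · rw [ofDigits_digits_eq (by omega), chi_mod hb, chi_div hb,
        ih _ (Nat.div_lt_self ha (by omega))]
      exact Nat.mod_add_div a b

theorem exists_chi_eq (hb : 2 ≤ b) {x : ℕ} (h : ∀ w, x / (b + 1) ^ w % (b + 1) ≠ b) :
    ∃ a, chi b a = x := by
  induction x using Nat.strong_induction_on with
  | _ x ih =>
    rcases Nat.eq_zero_or_pos x with rfl | hx
    · exact ⟨0, by simp [chi]⟩
    · obtain ⟨a, ha⟩ := ih (x / (b + 1)) (Nat.div_lt_self hx (by omega)) fun w => by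
        rw [Nat.div_div_eq_div_mul, ← pow_succ']
        exact h (w + 1)
      have h0 := h 0
      rw [pow_zero, Nat.div_one] at h0
      have h1 := Nat.mod_lt x (show 0 < b + 1 by omega)
      exact ⟨a * b + x % (b + 1), by
        rw [chi_mul_add hb _ (by omega), ha, Nat.div_add_mod']⟩

theorem chi_mul_pow (hb : 2 ≤ b) (q r : ℕ) : chi b (q * b ^ r) = chi b q * (b + 1) ^ r := by
  induction r with
  | zero => simp
  | succ r ih =>
    rw [pow_succ, ← mul_assoc, ← add_zero (q * b ^ r * b), chi_mul_add hb _ (by omega), ih]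
    ring

theorem chi_succ (hb : 2 ≤ b) {q : ℕ} (hq : ¬b ∣ q + 1) : chi b (q + 1) = chi b q + 1 := by
  have h1 := Nat.div_add_mod' q b
  have h2 := Nat.mod_lt q (show 0 < b by omega)
  have h3 : q % b + 1 < b := by
    by_contra h
    exact hq ⟨q / b + 1, by rw [mul_add, mul_comm]; omega⟩
  rw [← h1, add_assoc, chi_mul_add hb _ h2, chi_mul_add hb _ h3]
  ring

theorem chi_mul_pow_sub_one (hb : 2 ≤ b) (q r a : ℕ) (h : a + 1 = (q + 1) * b ^ r) :
    chi b a = chi b q * (b + 1) ^ r + subRepunit b r := by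
  induction r generalizing q with
  | zero =>
    obtain rfl : a = q := by simpa using h
    simp [subRepunit]
  | succ r ih =>
    rw [ih (q * b + (b - 1)), chi_mul_add hb _ (by omega), subRepunit]
    · ring
    · rw [h, add_assoc, Nat.sub_add_cancel (by omega)]
      ring

end Digits

/-! ### Glue strings between consecutive prefixes of small curling number -/

theorem rulerWord_chi_succ {b : ℕ} (hb : 2 ≤ b)
    (hinf : {k | curl (gPrefix (b + 1) k) ≤ b}.Infinite) (a : ℕ) :
    rulerWord b (glueChain b) (chi b (a + 1)) =
      rulerWord b (glueChain b) (chi b a) ++ Pstr b (ordb b (a + 1) + 1) := by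
  set r := ordb b (a + 1) with hr
  obtain ⟨q, hq⟩ := pow_ordb_dvd hb (show 1 ≤ a + 1 by omega)
  rw [← hr] at hq
  have hq0 : q ≠ 0 := by rintro rfl; simp at hq
  obtain ⟨q, rfl⟩ := Nat.exists_eq_succ_of_ne_zero hq0
  rw [Nat.succ_eq_add_one, mul_comm] at hq
  have hqb : ¬b ∣ q + 1 := by
    intro h
    refine ((ordb_eq_iff hb (by omega)).1 hr.symm).2 ?_
    rw [hq, pow_succ']
    exact Nat.mul_dvd_mul_right h _
  have hc : chi b (q + 1) = chi b q + 1 := chi_succ hb hqb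
  have hqc : ¬(b + 1) ∣ chi b q + 1 := by
    rw [← hc, Nat.dvd_iff_mod_eq_zero, chi_mod hb, ← Nat.dvd_iff_mod_eq_zero]
    exact hqb
  rw [chi_mul_pow_sub_one hb q r a hq, hq, chi_mul_pow hb, hc]
  exact rulerWord_mul_pow_eq_append_Pstr (by omega) hinf hqc

section SmallCurl

variable {m : ℕ}

theorem exists_chi_of_curl_le (hm : 1 ≤ m)
    (hinf : {k | curl (gPrefix (m + 1 + 1) k) ≤ m + 1}.Infinite) {k : ℕ}
    (hk : curl (gPrefix (m + 1) k) ≤ m) :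
    ∃ a, (rulerWord (m + 1) (glueChain (m + 1)) (chi (m + 1) a)).length = k := by
  have hT := glueSystem_glueChain (b := m + 1) (by omega) hinf
  obtain ⟨x, rfl⟩ := exists_rulerWord_eq (b := m + 1) (by omega) hinf (k := k) (by omega)
  rw [rulerWord_eq_gPrefix (by omega) hinf] at hk
  obtain ⟨a, rfl⟩ := exists_chi_eq (b := m + 1) (x := x) (by omega) fun w hw => by
    have := hT.le_curl_rulerWord_of_digit hw
    omega
  exact ⟨a, rfl⟩

theorem Tstr_eq_rulerWord_chi_iota (hm : 1 ≤ m)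
    (hinf : {k | curl (gPrefix (m + 1 + 1) k) ≤ m + 1}.Infinite)
    (hinf' : {k | curl (gPrefix (m + 1) k) ≤ m}.Infinite) (t : ℕ) :
    Tstr m t = rulerWord (m + 1) (glueChain (m + 1)) (chi (m + 1) (iota m t)) := by
  have hT := glueSystem_glueChain (b := m + 1) (by omega) hinf
  obtain ⟨a, ha⟩ := exists_chi_of_curl_le hm hinf (k := tau m t)
    (Nat.nth_mem_of_infinite (p := fun k => curl (gPrefix (m + 1) k) ≤ m) hinf' _)
  have h : Tstr m t = rulerWord (m + 1) (glueChain (m + 1)) (chi (m + 1) a) := by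
    rw [Tstr, ← ha, rulerWord_eq_gPrefix (by omega) hinf]
  have hi : iota m t = a := by
    rw [iota, h, rulerWord, count_gapWord fun i => hT.not_mem _]
    exact ofDigits_digits_chi (by omega) a
  rw [hi, h]

theorem curl_rulerWord_chi_le (hm : 1 ≤ m)
    (hinf : {k | curl (gPrefix (m + 1 + 1) k) ≤ m + 1}.Infinite) {a : ℕ} (ha : ¬(m + 1) ∣ a) :
    curl (rulerWord (m + 1) (glueChain (m + 1)) (chi (m + 1) a)) ≤ m := by
  refine (glueSystem_glueChain (by omega) hinf).curl_rulerWord_lt (by omega) (fun h => ha ?_)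
    (chi_digit_ne (by omega) a)
  rwa [Nat.dvd_iff_mod_eq_zero, chi_mod (by omega), ← Nat.dvd_iff_mod_eq_zero] at h

theorem iota_lt_iota_succ (hm : 1 ≤ m)
    (hinf : {k | curl (gPrefix (m + 1 + 1) k) ≤ m + 1}.Infinite)
    (hinf' : {k | curl (gPrefix (m + 1) k) ≤ m}.Infinite) (t : ℕ) :
    iota m (t + 1) < iota m (t + 2) := by
  have h : (Tstr m (t + 1)).length < (Tstr m (t + 2)).length := by
    rw [Tstr, Tstr, length_gPrefix, length_gPrefix]
    exact strictMono_tau hinf' (Nat.lt_succ_self t)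
  rw [Tstr_eq_rulerWord_chi_iota hm hinf hinf', Tstr_eq_rulerWord_chi_iota hm hinf hinf'] at h
  exact (strictMono_chi (by omega)).lt_iff_lt.1
    ((strictMono_length_rulerWord _).lt_iff_lt.1 h)

theorem iota_succ_le (hm : 1 ≤ m)
    (hinf : {k | curl (gPrefix (m + 1 + 1) k) ≤ m + 1}.Infinite)
    (hinf' : {k | curl (gPrefix (m + 1) k) ≤ m}.Infinite) {t a : ℕ} (hta : iota m (t + 1) < a)
    (ha : curl (rulerWord (m + 1) (glueChain (m + 1)) (chi (m + 1) a)) ≤ m) :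
    iota m (t + 2) ≤ a := by
  have hmono : StrictMono fun a =>
      (rulerWord (m + 1) (glueChain (m + 1)) (chi (m + 1) a)).length :=
    (strictMono_length_rulerWord _).comp (strictMono_chi (by omega))
  have htau : ∀ s, tau m s =
      (rulerWord (m + 1) (glueChain (m + 1)) (chi (m + 1) (iota m s))).length := fun s => by
    rw [← Tstr_eq_rulerWord_chi_iota hm hinf hinf', Tstr, length_gPrefix]
  by_contra hcon
  have h1 := hmono (not_le.1 hcon)
  simp only [← htau] at h1
  rw [← rulerWord_eq_gPrefix (by omega) hinf] at ha
  have h2 := Nat.le_nth_of_lt_nth_succ (p := fun k => curl (gPrefix (m + 1) k) ≤ m) h1 ha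
  change _ ≤ tau m (t + 1) at h2
  rw [htau] at h2
  have h3 := hmono.le_iff_le.1 h2
  omega

theorem glue_eq_drop (hm : 1 ≤ m)
    (hinf : {k | curl (gPrefix (m + 1 + 1) k) ≤ m + 1}.Infinite)
    (hinf' : {k | curl (gPrefix (m + 1) k) ≤ m}.Infinite) {t : ℕ} {S : List ℕ}
    (h : rulerWord (m + 1) (glueChain (m + 1)) (chi (m + 1) (iota m (t + 1))) =
      rulerWord (m + 1) (glueChain (m + 1)) (chi (m + 1) (iota m t)) ++ S) :
    glue m t = S := by
  rw [← Tstr_eq_rulerWord_chi_iota hm hinf hinf', ← Tstr_eq_rulerWord_chi_iota hm hinf hinf'] at h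
  change (Tstr m (t + 1)).drop (tau m t) = S
  rw [h, List.drop_left']
  rw [Tstr, length_gPrefix]

end SmallCurl

/-- Theorem `glue characterization`. For `m,t ≥ 1` there is `u ≥ 1`
with `S_t^(m) = P_u^(m+1)` or `S_t^(m) = P_u^(m+1)·(m+1)` (and then `u ≥ 2`). Precisely,
`ι_m(t+1) − ι_m(t) ∈ {1,2}` and, with `u := ord_{m+1}(ι_m(t)+1) + 1`: if
`ι_m(t+1) = ι_m(t)+1` then `S_t^(m) = P_u^(m+1)`, while if `ι_m(t+1) = ι_m(t)+2` then
`S_t^(m) = P_u^(m+1)·(m+1)` and `u ≥ 2`. -/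
theorem statement19 (hSH : StandingHyp) (m t : ℕ) (hm : 1 ≤ m) (ht : 1 ≤ t) :
    (∃ u : ℕ, 1 ≤ u ∧
      (glue m t = Pstr (m + 1) u ∨ (glue m t = Pstr (m + 1) u ++ [m + 1] ∧ 2 ≤ u))) ∧
    (iota m (t + 1) = iota m t + 1 ∨ iota m (t + 1) = iota m t + 2) ∧
    (iota m (t + 1) = iota m t + 1 →
      glue m t = Pstr (m + 1) (ordb (m + 1) (iota m t + 1) + 1)) ∧
    (iota m (t + 1) = iota m t + 2 →
      glue m t = Pstr (m + 1) (ordb (m + 1) (iota m t + 1) + 1) ++ [m + 1] ∧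
      2 ≤ ordb (m + 1) (iota m t + 1) + 1) := by
  have hinf := (hSH (m + 1) (by omega)).2
  have hinf' := (hSH m hm).2
  obtain ⟨t, rfl⟩ : ∃ s, t = s + 1 := ⟨t - 1, by omega⟩
  have hlt := iota_lt_iota_succ hm hinf hinf' t
  have hstep := rulerWord_chi_succ (b := m + 1) (by omega) hinf
  have not_dvd_succ : ∀ n, (m + 1) ∣ n → ¬(m + 1) ∣ n + 1 := fun n h h' => by
    have := Nat.le_of_dvd one_pos ((Nat.dvd_add_right h).1 h')
    omega
  have hone : iota m (t + 2) = iota m (t + 1) + 1 →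
      glue m (t + 1) = Pstr (m + 1) (ordb (m + 1) (iota m (t + 1) + 1) + 1) := by
    intro h
    refine glue_eq_drop hm hinf hinf' ?_
    rw [h, hstep]
  have hdvd : iota m (t + 2) ≠ iota m (t + 1) + 1 → (m + 1) ∣ iota m (t + 1) + 1 := by
    intro h
    by_contra hd
    have := iota_succ_le hm hinf hinf' (t := t) (a := iota m (t + 1) + 1)
      (by omega) (curl_rulerWord_chi_le hm hinf hd)
    omega
  have hcases : iota m (t + 2) = iota m (t + 1) + 1 ∨ iota m (t + 2) = iota m (t + 1) + 2 := by
    by_cases h : iota m (t + 2) = iota m (t + 1) + 1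
    · exact Or.inl h
    · have := iota_succ_le hm hinf hinf' (t := t) (a := iota m (t + 1) + 2) (by omega)
        (curl_rulerWord_chi_le hm hinf (not_dvd_succ _ (hdvd h)))
      omega
  have htwo : iota m (t + 2) = iota m (t + 1) + 2 →
      glue m (t + 1) = Pstr (m + 1) (ordb (m + 1) (iota m (t + 1) + 1) + 1) ++ [m + 1] ∧
      2 ≤ ordb (m + 1) (iota m (t + 1) + 1) + 1 := by
    intro h
    have hd := hdvd (by omega)
    refine ⟨glue_eq_drop hm hinf hinf' ?_, ?_⟩
    · rw [h, hstep (iota m (t + 1) + 1), hstep, ordb_eq_zero (by omega) (not_dvd_succ _ hd),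
        List.append_assoc]
      rfl
    · have := (pow_dvd_iff_le_ordb (c := m + 1) (n := iota m (t + 1) + 1) (z := 1) (by omega)
        (by omega)).1 (by simpa using hd)
      omega
  refine ⟨⟨ordb (m + 1) (iota m (t + 1) + 1) + 1, by omega, ?_⟩, hcases, hone, htwo⟩
  exact hcases.imp hone htwo
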